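/- Let α, β, γ ∈ ℂ with Re β > −2 and with β, β+1, β+2, β+3, β+4 not nonpositive integers, and let ρ > 0 be a real number. Then ∫_{0}^{ρ} t^{β+1}·E(α;β;i/t)·E(α+γ;β;−i/t) dt = ρ^{β+2}·( β·(β+1)·f(α−1, β+2, γ+1, β; i/ρ) − 2i·ρ·(β+1)·f(α−1, β+3, γ+2, β; i/ρ) − ρ²·f(α−1, β+4, γ+3, β; i/ρ) ), where for t > 0 and complex exponent w, t^w = exp(w·log t). -/

import Mathlib

open Complex

/-- MacRobert E-function with one upper and one lower parameter:
`E(a;b;z) = ∑ Γ(a+n)/(n!·Γ(b+n))·(−1/z)^n`. -/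
noncomputable def macE1 (a b z : ℂ) : ℂ :=
  ∑' n : ℕ, (Complex.Gamma (a + n) / ((n.factorial : ℂ) * Complex.Gamma (b + n))) * (-1 / z) ^ n

/-- MacRobert E-function with two upper and two lower parameters. -/
noncomputable def macE2 (a₁ a₂ b₁ b₂ z : ℂ) : ℂ :=
  ∑' n : ℕ, (Complex.Gamma (a₁ + n) * Complex.Gamma (a₂ + n) /
    ((n.factorial : ℂ) * Complex.Gamma (b₁ + n) * Complex.Gamma (b₂ + n))) * (-1 / z) ^ n

/-- `f(α,β,γ,δ;z) = ∑_{ν} z^{−ν}·Γ(α+γ+ν)/(ν!·Γ(β+ν)) · E(α+1, β+ν; δ, β+1+ν; z)`. -/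
noncomputable def fW (α β γ δ z : ℂ) : ℂ :=
  ∑' ν : ℕ, (z ^ (-(ν : ℤ)) * Complex.Gamma (α + γ + ν) /
    ((ν.factorial : ℂ) * Complex.Gamma (β + ν))) *
      macE2 (α + 1) (β + (ν : ℂ)) δ (β + 1 + (ν : ℂ)) z

/-- Pochhammer symbol `(a)_k = Γ(a+k)/Γ(a)`. -/
noncomputable def poch (a : ℂ) (k : ℕ) : ℂ := Complex.Gamma (a + k) / Complex.Gamma a

/-- The `n`-th term of the series of `macE1 a b (-1 / x)`. -/
noncomputable def macTerm (a b x : ℂ) (n : ℕ) : ℂ :=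
  Complex.Gamma (a + n) / ((n.factorial : ℂ) * Complex.Gamma (b + n)) * x ^ n

lemma eventually_add_natCast_ne_zero (a : ℂ) : ∀ᶠ n : ℕ in Filter.atTop, a + n ≠ 0 := by
  obtain ⟨N, hN⟩ := exists_nat_gt ‖a‖
  filter_upwards [Filter.eventually_ge_atTop N] with n hn h
  have h1 : a = -(n : ℂ) := eq_neg_of_add_eq_zero_left h
  have h2 : ‖a‖ = n := by rw [h1, norm_neg, Complex.norm_natCast]
  have h3 : (N : ℝ) ≤ n := by exact_mod_cast hn
  linarith

lemma macTerm_succ {a b : ℂ} (x : ℂ) {n : ℕ} (ha : a + n ≠ 0) (hb : b + n ≠ 0) :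
    macTerm a b x (n + 1) =
      (a + n) / (b + n) * (x / ((n + 1 : ℕ) : ℂ)) * macTerm a b x n := by
  have hn : ((n + 1 : ℕ) : ℂ) ≠ 0 := Nat.cast_ne_zero.mpr n.succ_ne_zero
  have h (c : ℂ) (hc : c + n ≠ 0) :
      Complex.Gamma (c + (n + 1 : ℕ)) = (c + n) * Complex.Gamma (c + n) := by
    rw [← Complex.Gamma_add_one _ hc]; push_cast; ring_nf
  simp only [macTerm]
  rw [h a ha, h b hb, Nat.factorial_succ, Nat.cast_mul, pow_succ]
  simp only [div_eq_mul_inv, mul_inv]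
  ring

lemma tendsto_add_natCast_div_add_natCast (a b : ℂ) :
    Filter.Tendsto (fun n : ℕ => (a + n) / (b + n)) Filter.atTop (nhds 1) := by
  have h (c : ℂ) : Filter.Tendsto (fun n : ℕ => c / (n : ℂ) + 1) Filter.atTop (nhds 1) := by
    simpa using (tendsto_const_div_atTop_nhds_zero_nat c).add_const 1
  have h2 := (h a).div (h b) one_ne_zero
  rw [div_one] at h2
  refine h2.congr' ?_
  filter_upwards [Filter.eventually_gt_atTop 0] with n hn
  have hn' : (n : ℂ) ≠ 0 := Nat.cast_ne_zero.mpr hn.ne'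
  simp only [Pi.div_apply]
  rw [div_add_one hn', div_add_one hn', div_div_div_cancel_right₀ hn']

lemma summable_norm_macTerm (a b x : ℂ) : Summable fun n => ‖macTerm a b x n‖ := by
  have h0 : Filter.Tendsto (fun n : ℕ => (a + n) / (b + n) * (x / ((n + 1 : ℕ) : ℂ)))
      Filter.atTop (nhds 0) := by
    simpa using (tendsto_add_natCast_div_add_natCast a b).mul
      ((tendsto_const_div_atTop_nhds_zero_nat x).comp (Filter.tendsto_add_atTop_nat 1))
  have h1 := h0.norm.eventually_le_const (show ‖(0 : ℂ)‖ < 1 / 2 by norm_num)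
  refine summable_of_ratio_norm_eventually_le (r := 1 / 2) (by norm_num) ?_
  filter_upwards [h1, eventually_add_natCast_ne_zero a, eventually_add_natCast_ne_zero b]
    with n hn ha hb
  rw [norm_norm, norm_norm, macTerm_succ x ha hb, norm_mul]
  gcongr

lemma macTerm_mul (a b x y : ℂ) (n : ℕ) :
    macTerm a b (x * y) n = macTerm a b x n * y ^ n := by
  simp only [macTerm, mul_pow]; ring

lemma macTerm_add_one (a b x : ℂ) (n : ℕ) :
    x * macTerm (a + 1) (b + 1) x n = ((n + 1 : ℕ) : ℂ) * macTerm a b x (n + 1) := by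
  have hn : ((n + 1 : ℕ) : ℂ) ≠ 0 := Nat.cast_ne_zero.mpr n.succ_ne_zero
  have h (c : ℂ) : c + 1 + n = c + (n + 1 : ℕ) := by push_cast; ring
  simp only [macTerm]
  rw [h a, h b, Nat.factorial_succ, Nat.cast_mul, pow_succ]
  simp only [div_eq_mul_inv, mul_inv]
  field_simp

/-- The common inner series `∑ Γ(a+n)/(n!·Γ(b+n))·xⁿ/(w+n)`. -/
noncomputable def macKernel (a b x w : ℂ) : ℂ := ∑' n : ℕ, macTerm a b x n / (w + n)

lemma norm_macTerm_div_le (a b x : ℂ) {c : ℝ} (hc : 0 < c) {w : ℂ} (hw : c ≤ w.re) (n : ℕ) :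
    ‖macTerm a b x n / (w + n)‖ ≤ ‖macTerm a b x n‖ / c := by
  rw [norm_div]
  have : c ≤ ‖w + n‖ := by
    refine le_trans ?_ (Complex.re_le_norm _)
    simp only [Complex.add_re, Complex.natCast_re]
    have : (0 : ℝ) ≤ n := n.cast_nonneg
    linarith
  gcongr

lemma norm_macKernel_le (a b x : ℂ) {c : ℝ} (hc : 0 < c) {w : ℂ} (hw : c ≤ w.re) :
    ‖macKernel a b x w‖ ≤ (∑' n, ‖macTerm a b x n‖) / c :=
  tsum_of_norm_bounded ((summable_norm_macTerm a b x).hasSum.div_const c)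
    fun n => norm_macTerm_div_le a b x hc hw n

lemma macE2_eq_macKernel (a b z : ℂ) {w : ℂ} (hw : 0 < w.re) :
    macE2 a w b (w + 1) z = macKernel a b (-1 / z) w := by
  refine tsum_congr fun n => ?_
  have hre : 0 < (w + n).re := by
    simp only [Complex.add_re, Complex.natCast_re]; positivity
  have h0 : w + n ≠ 0 := fun h => by simp [h] at hre
  have hG : Complex.Gamma (w + n) ≠ 0 := Complex.Gamma_ne_zero_of_re_pos hre
  rw [macTerm, show w + 1 + (n : ℂ) = w + n + 1 by ring, Complex.Gamma_add_one _ h0]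
  simp only [div_eq_mul_inv, mul_inv]
  field_simp

lemma hasSum_fW (α γ δ z : ℂ) {β : ℂ} (hβ : 0 < β.re) :
    HasSum (fun ν : ℕ => macTerm (α + γ) β z⁻¹ ν * macKernel (α + 1) δ (-1 / z) (β + ν))
      (fW α β γ δ z) := by
  have hre (ν : ℕ) : β.re ≤ (β + ν).re := by simp
  have hs : Summable fun ν : ℕ =>
      macTerm (α + γ) β z⁻¹ ν * macKernel (α + 1) δ (-1 / z) (β + ν) := by
    refine Summable.of_norm_bounded ((summable_norm_macTerm (α + γ) β z⁻¹).mul_right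
      ((∑' n, ‖macTerm (α + 1) δ (-1 / z) n‖) / β.re)) fun ν => ?_
    rw [norm_mul]
    gcongr
    exact norm_macKernel_le _ _ _ hβ (hre ν)
  convert hs.hasSum using 1
  refine tsum_congr fun ν => ?_
  rw [show β + 1 + (ν : ℂ) = β + ν + 1 by ring,
    macE2_eq_macKernel _ _ _ (hβ.trans_le (hre ν)), macTerm, zpow_neg, zpow_natCast, inv_pow]
  ring

lemma hasSum_natCast_mul_macTerm (a b x : ℂ) (g : ℕ → ℂ) {s : ℂ}
    (h : HasSum (fun n => macTerm (a + 1) (b + 1) x n * g (n + 1)) s) :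
    HasSum (fun n : ℕ => (n : ℂ) * macTerm a b x n * g n) (x * s) := by
  have h1 := h.mul_left x
  rw [← hasSum_nat_add_iff' 1]
  simpa [← mul_assoc, macTerm_add_one] using h1

lemma macTerm_eq_add_two (a b x : ℂ) (n : ℕ) (h0 : b + n ≠ 0) (h1 : b + 1 + n ≠ 0) :
    macTerm a b x n = (b + n) * (b + 1 + n) * macTerm a (b + 2) x n := by
  have hG : Complex.Gamma (b + 2 + n) = (b + 1 + n) * ((b + n) * Complex.Gamma (b + n)) := by
    rw [← Complex.Gamma_add_one _ h0, show b + n + 1 = b + 1 + (n : ℂ) by ring,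
      ← Complex.Gamma_add_one _ h1]
    ring_nf
  rw [macTerm, macTerm, hG]
  simp only [div_eq_mul_inv, mul_inv]
  field_simp

lemma integral_Ioo_cpow_mul_pow {ρ : ℝ} (hρ : 0 < ρ) {s : ℂ} (hs : -2 < s.re) (k : ℕ) :
    ∫ t in Set.Ioo (0 : ℝ) ρ, (t : ℂ) ^ (s + 1) * (t : ℂ) ^ k =
      (ρ : ℂ) ^ (s + 2) * (ρ : ℂ) ^ k / (s + 2 + k) := by
  have hk : (0 : ℝ) ≤ k := k.cast_nonneg
  have hre : -1 < (s + 1 + k).re := by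
    simp only [Complex.add_re, Complex.one_re, Complex.natCast_re]; linarith
  have h0 : s + 2 + k ≠ 0 := fun h => by
    have := congrArg Complex.re h
    simp only [Complex.add_re, Complex.re_ofNat, Complex.natCast_re, Complex.zero_re] at this
    linarith
  have hint := integral_cpow (a := 0) (b := ρ) (r := s + 1 + k) (Or.inl hre)
  rw [show s + 1 + k + 1 = s + 2 + (k : ℂ) by ring, Complex.ofReal_zero, Complex.zero_cpow h0,
    sub_zero, Complex.cpow_add _ _ (by exact_mod_cast hρ.ne'), Complex.cpow_natCast,
    intervalIntegral.integral_of_le hρ.le, MeasureTheory.integral_Ioc_eq_integral_Ioo] at hint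
  rw [← hint]
  refine MeasureTheory.setIntegral_congr_fun measurableSet_Ioo fun t ht => ?_
  rw [Complex.cpow_add (s + 1) k (by exact_mod_cast ht.1.ne'), Complex.cpow_natCast]

lemma integrableOn_Ioo_cpow {ρ : ℝ} (hρ : 0 < ρ) {s : ℂ} (hs : -1 < s.re) :
    MeasureTheory.IntegrableOn (fun t : ℝ => (t : ℂ) ^ s) (Set.Ioo 0 ρ) := by
  have h := intervalIntegral.intervalIntegrable_cpow' (a := 0) (b := ρ) hs
  rwa [intervalIntegrable_iff_integrableOn_Ioo_of_le hρ.le] at h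

/-- Termwise integration of a product of two power series against `t ^ (s + 1)`. -/
lemma hasSum_integral_cpow_mul_tsum_mul_tsum {ρ : ℝ} (hρ : 0 < ρ) {s : ℂ} (hs : -2 < s.re)
    {a b : ℕ → ℂ} (ha : Summable fun n => ‖a n * (ρ : ℂ) ^ n‖)
    (hb : Summable fun n => ‖b n * (ρ : ℂ) ^ n‖) :
    HasSum (fun p : ℕ × ℕ => (ρ : ℂ) ^ (s + 2) *
        ((b p.1 * (ρ : ℂ) ^ p.1) * ((a p.2 * (ρ : ℂ) ^ p.2) / (s + 2 + p.1 + p.2))))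
      (∫ t in Set.Ioo (0 : ℝ) ρ, (t : ℂ) ^ (s + 1) * (∑' n, a n * (t : ℂ) ^ n) *
        ∑' n, b n * (t : ℂ) ^ n) := by
  have hs1 : -1 < (s + 1).re := by simp only [Complex.add_re, Complex.one_re]; linarith
  have hle {t : ℝ} (ht : t ∈ Set.Ioo 0 ρ) (c : ℕ → ℂ) (n : ℕ) :
      ‖c n * (t : ℂ) ^ n‖ ≤ ‖c n * (ρ : ℂ) ^ n‖ := by
    simp only [norm_mul, norm_pow, Complex.norm_real, Real.norm_eq_abs, abs_of_pos ht.1,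
      abs_of_pos hρ]
    have := ht.1.le
    have := ht.2.le
    gcongr
  let F : ℕ × ℕ → ℝ → ℂ := fun p t =>
    (t : ℂ) ^ (s + 1) * ((b p.1 * (t : ℂ) ^ p.1) * (a p.2 * (t : ℂ) ^ p.2))
  have hbound (p : ℕ × ℕ) {t : ℝ} (ht : t ∈ Set.Ioo 0 ρ) :
      ‖F p t‖ ≤ ‖(t : ℂ) ^ (s + 1)‖ * (‖b p.1 * (ρ : ℂ) ^ p.1‖ * ‖a p.2 * (ρ : ℂ) ^ p.2‖) := by
    simp only [F]
    rw [norm_mul, norm_mul (b p.1 * _)]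
    gcongr
    · exact hle ht b _
    · exact hle ht a _
  have hc := integrableOn_Ioo_cpow hρ hs1
  have hF (p : ℕ × ℕ) : MeasureTheory.IntegrableOn (F p) (Set.Ioo 0 ρ) := by
    refine MeasureTheory.Integrable.mono' (hc.norm.mul_const _)
      (hc.aestronglyMeasurable.mul (Continuous.aestronglyMeasurable (by fun_prop)))
      ((MeasureTheory.ae_restrict_mem measurableSet_Ioo).mono fun t ht => hbound p ht)
  have hsum : Summable fun p : ℕ × ℕ => ∫ t in Set.Ioo (0 : ℝ) ρ, ‖F p t‖ := by
    refine Summable.of_nonneg_of_le (fun p => MeasureTheory.integral_nonneg fun t => norm_nonneg _)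
      (fun p => ?_) ((hb.mul_of_nonneg ha (fun _ => norm_nonneg _) fun _ => norm_nonneg _).mul_left
        (∫ t in Set.Ioo (0 : ℝ) ρ, ‖(t : ℂ) ^ (s + 1)‖))
    rw [← MeasureTheory.integral_mul_const]
    exact MeasureTheory.setIntegral_mono_on (hF p).norm (hc.norm.mul_const _) measurableSet_Ioo
      fun t ht => hbound p ht
  convert MeasureTheory.hasSum_integral_of_summable_integral_norm hF hsum using 1
  · rfl
  · funext p
    have h := integral_Ioo_cpow_mul_pow hρ hs (p.1 + p.2)
    have hFp : F p = fun t : ℝ =>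
        b p.1 * a p.2 * ((t : ℂ) ^ (s + 1) * (t : ℂ) ^ (p.1 + p.2)) := by
      funext t; simp only [F, pow_add]; ring
    rw [hFp, MeasureTheory.integral_const_mul, h, pow_add, Nat.cast_add, ← add_assoc]
    ring
  · refine MeasureTheory.setIntegral_congr_fun measurableSet_Ioo fun t ht => ?_
    have ha' : Summable fun n => ‖a n * (t : ℂ) ^ n‖ :=
      ha.of_nonneg_of_le (fun _ => norm_nonneg _) (hle ht a)
    have hb' : Summable fun n => ‖b n * (t : ℂ) ^ n‖ :=
      hb.of_nonneg_of_le (fun _ => norm_nonneg _) (hle ht b)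
    simp only [F]
    rw [tsum_mul_left, ← tsum_mul_tsum_of_summable_norm hb' ha']
    ring

lemma integral_cpow_mul_macE1_mul_macE1 {ρ : ℝ} (hρ : 0 < ρ) (a c : ℂ) {b : ℂ}
    (hb : -2 < b.re) :
    ∫ t in Set.Ioo (0 : ℝ) ρ,
        (t : ℂ) ^ (b + 1) * macE1 a b (I / (t : ℂ)) * macE1 c b (-I / (t : ℂ)) =
      (ρ : ℂ) ^ (b + 2) *
        ∑' m : ℕ, macTerm c b (-I * ρ) m * macKernel a b (I * ρ) (b + 2 + m) := by
  have h1 (t : ℂ) : -1 / (I / t) = I * t := by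
    rw [div_div_eq_mul_div, Complex.div_I]; ring
  have h2 (t : ℂ) : -1 / (-I / t) = -I * t := by
    rw [div_div_eq_mul_div, div_neg, Complex.div_I]; ring
  have hE1 (t : ℂ) : macE1 a b (I / t) = ∑' n, macTerm a b I n * t ^ n :=
    tsum_congr fun n => by rw [h1, ← macTerm_mul, macTerm]
  have hE2 (t : ℂ) : macE1 c b (-I / t) = ∑' n, macTerm c b (-I) n * t ^ n :=
    tsum_congr fun n => by rw [h2, ← macTerm_mul, macTerm]
  have h := hasSum_integral_cpow_mul_tsum_mul_tsum hρ hb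
    (a := macTerm a b I) (b := macTerm c b (-I))
    (by simpa only [← macTerm_mul] using summable_norm_macTerm a b (I * ρ))
    (by simpa only [← macTerm_mul] using summable_norm_macTerm c b (-I * ρ))
  simp only [hE1, hE2]
  rw [← h.tsum_eq, h.summable.tsum_prod]
  simp only [tsum_mul_left, ← macTerm_mul, macKernel]

theorem stmt14 (α β γ : ℂ) (hre : -2 < β.re)
    (hβ : ∀ n : ℕ, β ≠ -(n : ℂ)) (hβ1 : ∀ n : ℕ, β + 1 ≠ -(n : ℂ))
    (hβ2 : ∀ n : ℕ, β + 2 ≠ -(n : ℂ)) (hβ3 : ∀ n : ℕ, β + 3 ≠ -(n : ℂ))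
    (hβ4 : ∀ n : ℕ, β + 4 ≠ -(n : ℂ))
    (ρ : ℝ) (hρ : 0 < ρ) :
    ∫ t in Set.Ioo (0 : ℝ) ρ,
        (t : ℂ) ^ (β + 1) * macE1 α β (I / (t : ℂ)) * macE1 (α + γ) β (-I / (t : ℂ)) =
      (ρ : ℂ) ^ (β + 2) *
        (β * (β + 1) * fW (α - 1) (β + 2) (γ + 1) β (I / (ρ : ℂ)) -
          2 * I * (ρ : ℂ) * (β + 1) * fW (α - 1) (β + 3) (γ + 2) β (I / (ρ : ℂ)) -
          (ρ : ℂ) ^ 2 * fW (α - 1) (β + 4) (γ + 3) β (I / (ρ : ℂ))) := by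
  have hz : -1 / (I / (ρ : ℂ)) = I * ρ := by
    rw [div_div_eq_mul_div, Complex.div_I]; ring
  have hz' : (I / (ρ : ℂ))⁻¹ = -I * ρ := by
    rw [inv_div, Complex.div_I]; ring
  have hpos (c : ℝ) (hc : 2 ≤ c) : 0 < (β + (c : ℂ)).re := by
    simp only [Complex.add_re, Complex.ofReal_re]; linarith
  set g : ℕ → ℂ := fun m => macKernel α β (I * ρ) (β + 2 + m) with hg
  have f1 : HasSum (fun m => macTerm (α + γ) (β + 2) (-I * ρ) m * g m)
      (fW (α - 1) (β + 2) (γ + 1) β (I / (ρ : ℂ))) := by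
    have h := hasSum_fW (α - 1) (γ + 1) β (I / (ρ : ℂ)) (β := β + 2)
      (by simpa using hpos 2 (by norm_num))
    rw [hz, hz', sub_add_cancel, show α - 1 + (γ + 1) = α + γ by ring] at h
    exact h
  have f2 : HasSum (fun m => macTerm (α + γ + 1) (β + 2 + 1) (-I * ρ) m * g (m + 1))
      (fW (α - 1) (β + 3) (γ + 2) β (I / (ρ : ℂ))) := by
    have h := hasSum_fW (α - 1) (γ + 2) β (I / (ρ : ℂ)) (β := β + 3)
      (by simpa using hpos 3 (by norm_num))
    rw [hz, hz', sub_add_cancel, show α - 1 + (γ + 2) = α + γ + 1 by ring] at h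
    convert h using 2 with m
    simp only [hg]
    push_cast
    ring_nf
  have f3 : HasSum (fun m => macTerm (α + γ + 1 + 1) (β + 2 + 1 + 1) (-I * ρ) m * g (m + 1 + 1))
      (fW (α - 1) (β + 4) (γ + 3) β (I / (ρ : ℂ))) := by
    have h := hasSum_fW (α - 1) (γ + 3) β (I / (ρ : ℂ)) (β := β + 4)
      (by simpa using hpos 4 (by norm_num))
    rw [hz, hz', sub_add_cancel, show α - 1 + (γ + 3) = α + γ + 1 + 1 by ring] at h
    convert h using 2 with m
    simp only [hg]
    push_cast
    ring_nf
  have k2 := hasSum_natCast_mul_macTerm _ _ _ g f2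
  have k3 : HasSum (fun m : ℕ => (m : ℂ) * macTerm (α + γ) (β + 2) (-I * ρ) m * ((m - 1) * g m))
      (-I * ρ * (-I * ρ * fW (α - 1) (β + 4) (γ + 3) β (I / (ρ : ℂ)))) := by
    refine hasSum_natCast_mul_macTerm _ _ _ (fun m => ((m : ℂ) - 1) * g m) ?_
    convert hasSum_natCast_mul_macTerm _ _ _ (fun m => g (m + 1)) f3 using 2 with m
    push_cast
    ring
  rw [integral_cpow_mul_macE1_mul_macE1 hρ α (α + γ) hre]
  congr 1
  refine HasSum.tsum_eq ?_
  convert ((f1.mul_left (β * (β + 1))).add (k2.mul_left (2 * (β + 1)))).add k3 using 1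
  · rfl
  · funext m
    have h0 : β + m ≠ 0 := fun h => hβ m (eq_neg_of_add_eq_zero_left h)
    have h1 : β + 1 + m ≠ 0 := fun h => hβ1 m (eq_neg_of_add_eq_zero_left h)
    rw [macTerm_eq_add_two _ _ _ _ h0 h1]
    ring
  · linear_combination
      -(ρ : ℂ) ^ 2 * fW (α - 1) (β + 4) (γ + 3) β (I / (ρ : ℂ)) * Complex.I_sq
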